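/- Assume the coercivity conditions: S^j = Σ_{i=1}^{j} [κ_{i−1}(u_i−u_{i−1}) + d_i] ≥ 0 for all j = 1,…,n, and S_j = Σ_{i=j}^{n} [κ_i(u_{i+1}−u_i) + d_i] ≥ 0 for all j = 1,…,n. Then for every c ∈ ℝ there exist R > 0 and δ₁ > 0 such that every ξ̄ = (ξ₁,…,ξ_n) ∈ Ω with E(ξ̄) ≤ c satisfies |ξ̄| ≤ R (Euclidean norm) and ξ_{i+1} − ξ_i ≥ δ₁ for all i = 1,…,n−1. -/

import Mathlib

open Real Filter Finset

/-- The rescaled Gaussian cumulative distribution function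
`F(ξ) = (1/(2√π)) ∫_{-∞}^{ξ} e^{-s²/4} ds`. -/
noncomputable def F (x : ℝ) : ℝ :=
  (1 / (2 * Real.sqrt Real.pi)) * ∫ s in Set.Iio x, Real.exp (-s ^ 2 / 4)

/-- The derivative `F'(ξ) = (1/(2√π)) e^{-ξ²/4}`. -/
noncomputable def F' (x : ℝ) : ℝ :=
  (1 / (2 * Real.sqrt Real.pi)) * Real.exp (-x ^ 2 / 4)

/-- The functional
`E(ξ̄) = −Σ_{i=0}^{n} k_i(u_{i+1}−u_i) ln(F(ξ_{i+1}/a_i) − F(ξ_i/a_i)) + Σ_{i=1}^{n} d_i ξ_i²/4`,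
with the conventions `ξ₀ = −∞`, `ξ_{n+1} = +∞`, i.e. `F(ξ₀/a₀) = 0`, `F(ξ_{n+1}/a_n) = 1`.
Here `ξ : ℕ → ℝ`, only the values `ξ 1, …, ξ n` being relevant. -/
noncomputable def E (n : ℕ) (u a k d : ℕ → ℝ) (ξ : ℕ → ℝ) : ℝ :=
  -(∑ i ∈ Finset.range (n + 1), k i * (u (i + 1) - u i) *
      Real.log ((if i = n then 1 else F (ξ (i + 1) / a i)) -
        (if i = 0 then 0 else F (ξ i / a i))))
  + ∑ i ∈ Finset.Icc 1 n, d i * ξ i ^ 2 / 4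

/-- Reindexing of a point of `ℝⁿ` as the sequence `ξ_1, …, ξ_n` (paper indexing). -/
noncomputable def toSeq (n : ℕ) (x : EuclideanSpace ℝ (Fin n)) : ℕ → ℝ :=
  fun i => if h : i - 1 < n then x ⟨i - 1, h⟩ else 0

/-- The left-hand side of the `i`-th equation (`1 ≤ i ≤ n`) of the Stefan system:
`d_i ξ_i/2 + k_i(u_{i+1}−u_i) F'(ξ_i/a_i)/(a_i (F(ξ_{i+1}/a_i) − F(ξ_i/a_i)))
 − k_{i−1}(u_i−u_{i−1}) F'(ξ_i/a_{i−1})/(a_{i−1} (F(ξ_i/a_{i−1}) − F(ξ_{i−1}/a_{i−1})))`,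
with the conventions `ξ₀ = −∞` (so `F(ξ₀/a₀) = 0`) and `ξ_{n+1} = +∞` (so `F(ξ_{n+1}/a_n) = 1`). -/
noncomputable def stefanLHS (n : ℕ) (u a k d : ℕ → ℝ) (ξ : ℕ → ℝ) (i : ℕ) : ℝ :=
  d i * ξ i / 2
  + k i * (u (i + 1) - u i) * F' (ξ i / a i) /
      (a i * ((if i = n then 1 else F (ξ (i + 1) / a i)) - F (ξ i / a i)))
  - k (i - 1) * (u i - u (i - 1)) * F' (ξ i / a (i - 1)) /
      (a (i - 1) * (F (ξ i / a (i - 1)) - (if i = 1 then 0 else F (ξ (i - 1) / a (i - 1)))))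

theorem integrable_exp_neg_sq_div_four : MeasureTheory.Integrable fun s : ℝ => exp (-s ^ 2 / 4) := by
  have h := integrable_exp_neg_mul_sq (b := 1 / 4) (by norm_num)
  refine h.congr (Eventually.of_forall fun s => ?_)
  simp only
  ring_nf

theorem integral_exp_neg_sq_div_four : ∫ s : ℝ, exp (-s ^ 2 / 4) = 2 * √π := by
  have h := integral_gaussian (1 / 4)
  have h4 : √(π / (1 / 4)) = 2 * √π := by
    rw [show π / (1 / 4) = 2 ^ 2 * π by ring, Real.sqrt_mul (by norm_num),
      Real.sqrt_sq (by norm_num)]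
  rw [h4] at h
  rw [← h]
  congr 1 with s
  ring_nf

theorem one_le_two_mul_sqrt_pi : 1 ≤ 2 * √π := by
  have : 1 ≤ √π := Real.one_le_sqrt.2 (by linarith [Real.pi_gt_three])
  linarith

theorem F_mul (x : ℝ) : F x * (2 * √π) = ∫ s in Set.Iic x, exp (-s ^ 2 / 4) := by
  have h : (2 * √π) ≠ 0 := by positivity
  rw [F, MeasureTheory.integral_Iic_eq_integral_Iio]
  field_simp

theorem F_sub_mul (x y : ℝ) : (F y - F x) * (2 * √π) = ∫ s in x..y, exp (-s ^ 2 / 4) := by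
  rw [sub_mul, F_mul, F_mul]
  exact intervalIntegral.integral_Iic_sub_Iic integrable_exp_neg_sq_div_four.integrableOn
    integrable_exp_neg_sq_div_four.integrableOn

theorem one_sub_F_mul (x : ℝ) :
    (1 - F x) * (2 * √π) = ∫ s in Set.Ioi x, exp (-s ^ 2 / 4) := by
  rw [sub_mul, F_mul, one_mul, ← integral_exp_neg_sq_div_four,
    ← intervalIntegral.integral_Iic_add_Ioi integrable_exp_neg_sq_div_four.integrableOn
      integrable_exp_neg_sq_div_four.integrableOn (b := x)]
  ring

theorem F_neg (x : ℝ) : F (-x) = 1 - F x := by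
  have h : (2 * √π) ≠ 0 := by positivity
  have h1 : ∫ s in Set.Iic (-x), exp (-s ^ 2 / 4) = ∫ s in Set.Ioi x, exp (-s ^ 2 / 4) := by
    have := integral_comp_neg_Iic (-x) (fun s => exp (-s ^ 2 / 4))
    simpa using this
  rw [← F_mul, ← one_sub_F_mul] at h1
  exact mul_right_cancel₀ h h1

theorem F_nonneg (x : ℝ) : 0 ≤ F x :=
  mul_nonneg (by positivity) (MeasureTheory.integral_nonneg fun _ => (exp_pos _).le)

theorem F_strictMono : StrictMono F := by
  intro x y hxy
  have h : 0 < (F y - F x) * (2 * √π) := by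
    rw [F_sub_mul]
    exact intervalIntegral.intervalIntegral_pos_of_pos
      integrable_exp_neg_sq_div_four.intervalIntegrable (fun _ => exp_pos _) hxy
  have := pos_of_mul_pos_left h (by positivity)
  linarith

theorem F_pos (x : ℝ) : 0 < F x :=
  (F_nonneg (x - 1)).trans_lt (F_strictMono (by linarith))

theorem F_lt_one (x : ℝ) : F x < 1 := by
  have := F_pos (-x)
  rw [F_neg] at this
  linarith

theorem F_sub_le_sub_mul_exp {x y : ℝ} (hxy : x < y) :
    F y - F x ≤ (y - x) * exp (-(max x 0 ^ 2 + max (-y) 0 ^ 2) / 4) := by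
  have hb : ∀ s ∈ Set.Icc x y,
      exp (-s ^ 2 / 4) ≤ exp (-(max x 0 ^ 2 + max (-y) 0 ^ 2) / 4) := by
    intro s hs
    rw [exp_le_exp]
    rcases le_total x 0 with h | h <;> rcases le_total (-y) 0 with h' | h' <;>
      simp only [max_eq_left h, max_eq_right h, max_eq_left h', max_eq_right h'] <;>
      nlinarith [hs.1, hs.2]
  have h : (F y - F x) * (2 * √π) ≤
      (y - x) * exp (-(max x 0 ^ 2 + max (-y) 0 ^ 2) / 4) := by
    rw [F_sub_mul]
    have := intervalIntegral.integral_mono_on hxy.le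
      integrable_exp_neg_sq_div_four.intervalIntegrable
      (intervalIntegrable_const (c := exp (-(max x 0 ^ 2 + max (-y) 0 ^ 2) / 4))) hb
    simpa using this
  refine le_trans ?_ h
  exact le_mul_of_one_le_right (by linarith [F_strictMono hxy]) one_le_two_mul_sqrt_pi

theorem one_sub_F_le_exp {x : ℝ} (hx : 0 ≤ x) : 1 - F x ≤ exp (-x ^ 2 / 4) := by
  have hi := integrable_exp_neg_sq_div_four.comp_sub_right x
  have h : (1 - F x) * (2 * √π) ≤ exp (-x ^ 2 / 4) * (2 * √π) := by
    rw [one_sub_F_mul]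
    calc ∫ s in Set.Ioi x, exp (-s ^ 2 / 4)
        ≤ ∫ s in Set.Ioi x, exp (-x ^ 2 / 4) * exp (-(s - x) ^ 2 / 4) := by
          refine MeasureTheory.setIntegral_mono_on integrable_exp_neg_sq_div_four.integrableOn
            (hi.const_mul _).integrableOn measurableSet_Ioi fun s hs => ?_
          rw [← exp_add, exp_le_exp]
          nlinarith [Set.mem_Ioi.1 hs]
      _ ≤ ∫ s, exp (-x ^ 2 / 4) * exp (-(s - x) ^ 2 / 4) :=
          MeasureTheory.setIntegral_le_integral (hi.const_mul _)
            (Eventually.of_forall fun s => by positivity)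
      _ = exp (-x ^ 2 / 4) * (2 * √π) := by
          rw [MeasureTheory.integral_const_mul,
            MeasureTheory.integral_sub_right_eq_self (fun s => exp (-s ^ 2 / 4)),
            integral_exp_neg_sq_div_four]
  exact le_of_mul_le_mul_right h (by positivity)

theorem mul_one_sub_F_le_exp {x : ℝ} (hx : 0 < x) : x * (1 - F x) ≤ exp (-x ^ 2 / 4) := by
  have hx2 : -x / 2 < 0 := by linarith
  have h : (1 - F x) * (2 * √π) ≤ 2 / x * exp (-x ^ 2 / 4) := by
    rw [one_sub_F_mul]
    calc ∫ s in Set.Ioi x, exp (-s ^ 2 / 4)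
        ≤ ∫ s in Set.Ioi x, exp (x ^ 2 / 4) * exp (-x / 2 * s) := by
          refine MeasureTheory.setIntegral_mono_on integrable_exp_neg_sq_div_four.integrableOn
            ((integrableOn_exp_mul_Ioi hx2 x).const_mul _) measurableSet_Ioi fun s hs => ?_
          rw [← exp_add, exp_le_exp]
          nlinarith [sq_nonneg (s - x)]
      _ = 2 / x * exp (-x ^ 2 / 4) := by
          rw [MeasureTheory.integral_const_mul, integral_exp_mul_Ioi hx2,
            show -x ^ 2 / 4 = x ^ 2 / 4 + -x / 2 * x by ring, exp_add]
          field_simp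
  have hp : 1 ≤ √π := Real.one_le_sqrt.2 (by linarith [Real.pi_gt_three])
  have hF := F_lt_one x
  have h3 : x * ((1 - F x) * (2 * √π)) ≤ x * (2 / x * exp (-x ^ 2 / 4)) :=
    mul_le_mul_of_nonneg_left h hx.le
  have h4 : x * (2 / x * exp (-x ^ 2 / 4)) = 2 * exp (-x ^ 2 / 4) := by field_simp
  nlinarith [mul_pos hx (sub_pos.2 hF)]

theorem one_sub_F_le_exp_max (x : ℝ) : 1 - F x ≤ exp (-max x 0 ^ 2 / 4) := by
  rcases le_total 0 x with h | h
  · simpa [max_eq_left h] using one_sub_F_le_exp h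
  · simpa [max_eq_right h] using F_nonneg x

theorem F_le_exp_max (y : ℝ) : F y ≤ exp (-max (-y) 0 ^ 2 / 4) := by
  have h := one_sub_F_le_exp_max (-y)
  rw [F_neg] at h
  linarith

theorem F_sub_le_exp_max {x y : ℝ} (hxy : x < y) :
    F y - F x ≤ exp (-(max x 0 ^ 2 + max (-y) 0 ^ 2) / 4) := by
  rcases le_total 0 x with h | h
  · have hy : -y ≤ 0 := by linarith
    have := one_sub_F_le_exp_max x
    rw [max_eq_right hy]
    simp only [ne_eq, OfNat.ofNat_ne_zero, not_false_eq_true, zero_pow, add_zero]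
    linarith [F_lt_one y]
  · have := F_le_exp_max y
    rw [max_eq_right h]
    simp only [ne_eq, OfNat.ofNat_ne_zero, not_false_eq_true, zero_pow, zero_add]
    linarith [F_nonneg x]

theorem max_div_zero {x b : ℝ} (hb : 0 < b) : max (x / b) 0 = max x 0 / b := by
  rw [← max_div_div_right hb.le, zero_div]

theorem neg_div_mul_four (p b : ℝ) : -(p / b) ^ 2 / 4 = -(p ^ 2 / 4) / b ^ 2 := by
  ring

/-- The fraction of the Gaussian mass carried by the `i`-th phase. -/
noncomputable def phaseMass (n : ℕ) (a ξ : ℕ → ℝ) (i : ℕ) : ℝ :=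
  (if i = n then 1 else F (ξ (i + 1) / a i)) - (if i = 0 then 0 else F (ξ i / a i))

/-- The quadratic growth rate of minus the logarithm of the `i`-th phase mass. -/
noncomputable def phaseRate (n : ℕ) (ξ : ℕ → ℝ) (i : ℕ) : ℝ :=
  (if i = 0 then 0 else max (ξ i) 0 ^ 2 / 4) +
    (if i = n then 0 else max (-ξ (i + 1)) 0 ^ 2 / 4)

theorem phaseMass_pos {n : ℕ} {a ξ : ℕ → ℝ} {i : ℕ} (hn : 1 ≤ n) (hi : i ≤ n) (ha : 0 < a i)
    (hξ : ∀ i, 1 ≤ i → i < n → ξ i < ξ (i + 1)) : 0 < phaseMass n a ξ i := by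
  unfold phaseMass
  split_ifs with h1 h2 h2
  · omega
  · linarith [F_lt_one (ξ i / a i)]
  · linarith [F_pos (ξ (i + 1) / a i)]
  · have := F_strictMono (div_lt_div_of_pos_right (hξ i (by omega) (by omega)) ha)
    linarith

theorem phaseMass_le_exp {n : ℕ} {a ξ : ℕ → ℝ} {i : ℕ} (hn : 1 ≤ n) (hi : i ≤ n) (ha : 0 < a i)
    (hξ : ∀ i, 1 ≤ i → i < n → ξ i < ξ (i + 1)) :
    phaseMass n a ξ i ≤ exp (-phaseRate n ξ i / a i ^ 2) := by
  unfold phaseMass phaseRate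
  split_ifs with h1 h2 h2
  · omega
  · have := one_sub_F_le_exp_max (ξ i / a i)
    rw [max_div_zero ha, neg_div_mul_four] at this
    simpa using this
  · have := F_le_exp_max (ξ (i + 1) / a i)
    rw [← neg_div, max_div_zero ha, neg_div_mul_four] at this
    simpa using this
  · have := F_sub_le_exp_max (div_lt_div_of_pos_right (hξ i (by omega) (by omega)) ha)
    rw [← neg_div, max_div_zero ha, max_div_zero ha] at this
    refine this.trans_eq ?_
    congr 1
    ring

/-- Interior phases: the mass is also controlled by the width of the phase. -/
theorem mul_phaseMass_le_width {n : ℕ} {a ξ : ℕ → ℝ} {i : ℕ} (h1 : 1 ≤ i) (hi : i < n)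
    (ha : 0 < a i) (hξ : ξ i < ξ (i + 1)) :
    a i * phaseMass n a ξ i ≤ (ξ (i + 1) - ξ i) * exp (-phaseRate n ξ i / a i ^ 2) := by
  have h := F_sub_le_sub_mul_exp (div_lt_div_of_pos_right hξ ha)
  rw [← neg_div, max_div_zero ha, max_div_zero ha] at h
  have h' := mul_le_mul_of_nonneg_left h ha.le
  unfold phaseMass phaseRate
  rw [if_neg hi.ne, if_neg (by omega), if_neg (by omega), if_neg hi.ne]
  refine h'.trans_eq ?_
  rw [← mul_assoc]
  congr 1
  · field_simp
  · congr 1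
    ring

/-- A phase whose left end `ξ i` is positive has little mass when `ξ i` is large. -/
theorem mul_phaseMass_le_of_pos {n : ℕ} {a ξ : ℕ → ℝ} {i : ℕ} (h1 : 1 ≤ i) (hi : i ≤ n)
    (ha : 0 < a i) (hξ : ∀ i, 1 ≤ i → i < n → ξ i < ξ (i + 1)) (hpos : 0 < ξ i) :
    ξ i * phaseMass n a ξ i ≤ a i * exp (-phaseRate n ξ i / a i ^ 2) := by
  have h := mul_le_mul_of_nonneg_left (mul_one_sub_F_le_exp (div_pos hpos ha)) ha.le
  have hr : phaseRate n ξ i = ξ i ^ 2 / 4 := by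
    unfold phaseRate
    rw [if_neg (by omega), max_eq_left hpos.le]
    split_ifs with h2
    · simp
    · have := hξ i h1 (by omega)
      rw [max_eq_right (by linarith)]
      simp
  have hm : phaseMass n a ξ i ≤ 1 - F (ξ i / a i) := by
    unfold phaseMass
    rw [if_neg (by omega : ¬ i = 0)]
    split_ifs
    · exact le_rfl
    · linarith [F_lt_one (ξ (i + 1) / a i)]
  rw [neg_div_mul_four, ← mul_assoc, mul_div_cancel₀ _ ha.ne'] at h
  rw [hr]
  exact (mul_le_mul_of_nonneg_left hm hpos.le).trans h

/-- A phase whose right end `ξ (i + 1)` is negative has little mass when `-ξ (i + 1)` is large. -/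
theorem mul_phaseMass_le_of_neg {n : ℕ} {a ξ : ℕ → ℝ} {i : ℕ} (hi : i < n)
    (ha : 0 < a i) (hξ : ∀ i, 1 ≤ i → i < n → ξ i < ξ (i + 1)) (hneg : ξ (i + 1) < 0) :
    -ξ (i + 1) * phaseMass n a ξ i ≤ a i * exp (-phaseRate n ξ i / a i ^ 2) := by
  have hpos : 0 < -ξ (i + 1) := by linarith
  have h := mul_le_mul_of_nonneg_left (mul_one_sub_F_le_exp (div_pos hpos ha)) ha.le
  have hr : phaseRate n ξ i = (-ξ (i + 1)) ^ 2 / 4 := by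
    unfold phaseRate
    rw [if_neg hi.ne, max_eq_left hpos.le]
    split_ifs with h2
    · simp
    · have := hξ i (by omega) hi
      rw [max_eq_right (by linarith)]
      simp
  have hm : phaseMass n a ξ i ≤ 1 - F (-ξ (i + 1) / a i) := by
    unfold phaseMass
    rw [if_neg hi.ne, neg_div, F_neg]
    split_ifs
    · linarith
    · linarith [F_nonneg (ξ i / a i)]
  rw [neg_div_mul_four, ← mul_assoc, mul_div_cancel₀ _ ha.ne'] at h
  rw [hr]
  exact (mul_le_mul_of_nonneg_left hm hpos.le).trans h

theorem sum_Icc_one_eq_sum_range (f : ℕ → ℝ) (n : ℕ) :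
    ∑ i ∈ Finset.Icc 1 n, f i = ∑ i ∈ Finset.range n, f (i + 1) := by
  induction n with
  | zero => simp
  | succ n ih => rw [Finset.sum_Icc_succ_top (by omega), ih, Finset.sum_range_succ]

/-- Summation by parts: nonnegative initial sums against an antitone nonnegative weight. -/
theorem sum_mul_nonneg_of_antitone {n : ℕ} (hn : 1 ≤ n) {s m : ℕ → ℝ}
    (hs : ∀ j, 1 ≤ j → j ≤ n → 0 ≤ ∑ i ∈ Finset.Icc 1 j, s i)
    (hm : ∀ i, 1 ≤ i → i < n → m (i + 1) ≤ m i) (hm0 : 0 ≤ m n) :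
    0 ≤ ∑ i ∈ Finset.Icc 1 n, s i * m i := by
  have key : ∀ j, 1 ≤ j → j ≤ n →
      m j * ∑ i ∈ Finset.Icc 1 j, s i ≤ ∑ i ∈ Finset.Icc 1 j, s i * m i := by
    intro j hj
    induction j, hj using Nat.le_induction with
    | base => intro _; simp [mul_comm]
    | succ j hj ih =>
      intro hjn
      rw [Finset.sum_Icc_succ_top (by omega), Finset.sum_Icc_succ_top (by omega)]
      have := mul_le_mul_of_nonneg_right (hm j hj (by omega)) (hs j hj (by omega))
      linarith [ih (by omega)]
  exact (mul_nonneg hm0 (hs n hn le_rfl)).trans (key n hn le_rfl)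

/-- Summation by parts: nonnegative tail sums against a monotone nonnegative weight. -/
theorem sum_mul_nonneg_of_monotone {n : ℕ} (hn : 1 ≤ n) {s m : ℕ → ℝ}
    (hs : ∀ j, 1 ≤ j → j ≤ n → 0 ≤ ∑ i ∈ Finset.Icc j n, s i)
    (hm : ∀ i, 1 ≤ i → i < n → m i ≤ m (i + 1)) (hm0 : 0 ≤ m 1) :
    0 ≤ ∑ i ∈ Finset.Icc 1 n, s i * m i := by
  have key : ∀ t, t < n →
      m (n - t) * ∑ i ∈ Finset.Icc (n - t) n, s i ≤ ∑ i ∈ Finset.Icc (n - t) n, s i * m i := by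
    intro t
    induction t with
    | zero => intro _; simp [mul_comm]
    | succ t ih =>
      intro ht
      obtain ⟨j, hj⟩ : ∃ j, n - (t + 1) = j := ⟨_, rfl⟩
      have hj' : n - t = j + 1 := by omega
      have h1 := ih (by omega)
      rw [hj'] at h1
      rw [hj, ← Finset.add_sum_Ioc_eq_sum_Icc (by omega), ← Finset.add_sum_Ioc_eq_sum_Icc (by omega),
        ← Finset.Icc_add_one_left_eq_Ioc]
      have := mul_le_mul_of_nonneg_right (hm j (by omega) (by omega))
        (hs (j + 1) (by omega) (by omega))
      linarith
  have h := key (n - 1) (by omega)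
  rw [show n - (n - 1) = 1 by omega] at h
  exact (mul_nonneg hm0 (hs 1 le_rfl hn)).trans h

theorem max_sq_add_max_neg_sq (x : ℝ) : x ^ 2 / 4 = max x 0 ^ 2 / 4 + max (-x) 0 ^ 2 / 4 := by
  rcases le_total 0 x with h | h
  · rw [max_eq_left h, max_eq_right (by linarith)]
    ring
  · rw [max_eq_right h, max_eq_left (by linarith)]
    ring

theorem quadratic_part_nonneg {n : ℕ} (hn : 1 ≤ n) {u a k d ξ : ℕ → ℝ}
    (hS1 : ∀ j, 1 ≤ j → j ≤ n →
      0 ≤ ∑ i ∈ Finset.Icc 1 j, (k (i - 1) / a (i - 1) ^ 2 * (u i - u (i - 1)) + d i))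
    (hS2 : ∀ j, 1 ≤ j → j ≤ n →
      0 ≤ ∑ i ∈ Finset.Icc j n, (k i / a i ^ 2 * (u (i + 1) - u i) + d i))
    (hξ : ∀ i, 1 ≤ i → i < n → ξ i < ξ (i + 1)) :
    0 ≤ ∑ i ∈ Finset.range (n + 1), k i * (u (i + 1) - u i) * (phaseRate n ξ i / a i ^ 2)
      + ∑ i ∈ Finset.Icc 1 n, d i * ξ i ^ 2 / 4 := by
  have h1 := sum_mul_nonneg_of_antitone hn hS1 (m := fun i => max (-ξ i) 0 ^ 2 / 4)
    (fun i hi hin => by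
      have : max (-ξ (i + 1)) 0 ≤ max (-ξ i) 0 := max_le_max_right _ (by linarith [hξ i hi hin])
      have h0 : 0 ≤ max (-ξ (i + 1)) 0 := le_max_right _ _
      gcongr) (by positivity)
  have h2 := sum_mul_nonneg_of_monotone hn hS2 (m := fun i => max (ξ i) 0 ^ 2 / 4)
    (fun i hi hin => by
      have : max (ξ i) 0 ≤ max (ξ (i + 1)) 0 := max_le_max_right _ (hξ i hi hin).le
      have h0 : 0 ≤ max (ξ i) 0 := le_max_right _ _
      gcongr) (by positivity)
  refine (add_nonneg h1 h2).trans_eq ?_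
  simp only [phaseRate, add_div, mul_add, Finset.sum_add_distrib]
  rw [Finset.sum_range_succ', Finset.sum_range_succ (n := n)]
  simp only [sum_Icc_one_eq_sum_range, if_true, zero_div, mul_zero, add_zero,
    Nat.add_sub_cancel, Nat.add_eq_zero_iff, one_ne_zero, and_false, if_false]
  simp only [← Finset.sum_add_distrib]
  refine Finset.sum_congr rfl fun i hi => ?_
  rw [if_neg (Finset.mem_range.1 hi).ne]
  have := max_sq_add_max_neg_sq (ξ (i + 1))
  rw [mul_div_assoc (d (i + 1)), this]
  ring

/-- On a sublevel set of the energy every phase mass is, up to a constant factor, as large as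
its Gaussian upper bound. -/
theorem exp_mul_exp_le_phaseMass {n : ℕ} (hn : 1 ≤ n) {u a k d ξ : ℕ → ℝ}
    (hu : ∀ i ≤ n, u i < u (i + 1))
    (ha : ∀ i ≤ n, 0 < a i)
    (hk : ∀ i ≤ n, 0 < k i)
    (hS1 : ∀ j, 1 ≤ j → j ≤ n →
      0 ≤ ∑ i ∈ Finset.Icc 1 j, (k (i - 1) / a (i - 1) ^ 2 * (u i - u (i - 1)) + d i))
    (hS2 : ∀ j, 1 ≤ j → j ≤ n →
      0 ≤ ∑ i ∈ Finset.Icc j n, (k i / a i ^ 2 * (u (i + 1) - u i) + d i))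
    (hξ : ∀ i, 1 ≤ i → i < n → ξ i < ξ (i + 1)) {c : ℝ} (hE : E n u a k d ξ ≤ c)
    {i : ℕ} (hi : i ≤ n) :
    exp (-(c / (k i * (u (i + 1) - u i)))) * exp (-phaseRate n ξ i / a i ^ 2) ≤
      phaseMass n a ξ i := by
  have hw : ∀ i ≤ n, 0 < k i * (u (i + 1) - u i) := fun i hi =>
    mul_pos (hk i hi) (sub_pos.2 (hu i hi))
  have hq := quadratic_part_nonneg hn hS1 hS2 hξ
  have hE' : E n u a k d ξ = -(∑ i ∈ Finset.range (n + 1), k i * (u (i + 1) - u i) *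
      Real.log (phaseMass n a ξ i)) + ∑ i ∈ Finset.Icc 1 n, d i * ξ i ^ 2 / 4 := rfl
  have hnonneg : ∀ i ∈ Finset.range (n + 1), 0 ≤ k i * (u (i + 1) - u i) *
      (-Real.log (phaseMass n a ξ i) - phaseRate n ξ i / a i ^ 2) := by
    intro i hi
    have hi : i ≤ n := by simpa [Nat.lt_succ_iff] using hi
    have h1 := phaseMass_le_exp hn hi (ha i hi) hξ
    rw [← Real.log_le_iff_le_exp (phaseMass_pos hn hi (ha i hi) hξ), neg_div] at h1
    exact mul_nonneg (hw i hi).le (by linarith)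
  have hle := Finset.single_le_sum hnonneg (Finset.mem_range.2 (Nat.lt_succ_of_le hi))
  have hsum : ∑ i ∈ Finset.range (n + 1), k i * (u (i + 1) - u i) *
      (-Real.log (phaseMass n a ξ i) - phaseRate n ξ i / a i ^ 2) ≤ c := by
    simp only [mul_sub, mul_neg, Finset.sum_sub_distrib, Finset.sum_neg_distrib] at *
    linarith
  have h2 := (le_div_iff₀' (hw i hi)).2 (hle.trans hsum)
  rw [← exp_add, ← Real.le_log_iff_exp_le (phaseMass_pos hn hi (ha i hi) hξ), neg_div]
  linarith

/-- Under the coercivity conditions: for every `c` there are `R > 0` and `δ₁ > 0` such that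
every `ξ̄ ∈ Ω` with `E(ξ̄) ≤ c` satisfies `|ξ̄| ≤ R` (Euclidean norm) and
`ξ_{i+1} − ξ_i ≥ δ₁` for all `i = 1,…,n−1`. -/
theorem stmt8 (n : ℕ) (hn : 1 ≤ n) (u a k d : ℕ → ℝ)
    (hu : ∀ i ≤ n, u i < u (i + 1))
    (ha : ∀ i ≤ n, 0 < a i)
    (hk : ∀ i ≤ n, 0 < k i)
    (hS1 : ∀ j, 1 ≤ j → j ≤ n →
      0 ≤ ∑ i ∈ Finset.Icc 1 j, (k (i - 1) / a (i - 1) ^ 2 * (u i - u (i - 1)) + d i))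
    (hS2 : ∀ j, 1 ≤ j → j ≤ n →
      0 ≤ ∑ i ∈ Finset.Icc j n, (k i / a i ^ 2 * (u (i + 1) - u i) + d i)) :
    ∀ c : ℝ, ∃ R > (0 : ℝ), ∃ δ₁ > (0 : ℝ), ∀ x : EuclideanSpace ℝ (Fin n),
      (∀ i j : Fin n, i < j → x i < x j) → E n u a k d (toSeq n x) ≤ c →
        ‖x‖ ≤ R ∧ ∀ i, 1 ≤ i → i < n → δ₁ ≤ toSeq n x (i + 1) - toSeq n x i := by
  intro c
  set q : ℕ → ℝ := fun i => exp (c / (k i * (u (i + 1) - u i))) with hq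
  have hq0 : ∀ i, 0 < q i := fun i => exp_pos _
  have hR : ∀ i ≤ n, a i * q i ≤ ∑ j ∈ Finset.range (n + 1), a j * q j := fun i hi =>
    Finset.single_le_sum (f := fun j => a j * q j)
      (fun j hj => (mul_pos (ha j (by simpa [Nat.lt_succ_iff] using hj)) (hq0 j)).le)
      (Finset.mem_range.2 (Nat.lt_succ_of_le hi))
  have hδ : ∀ i ≤ n, q i / a i ≤ ∑ j ∈ Finset.range (n + 1), q j / a j := fun i hi =>
    Finset.single_le_sum (f := fun j => q j / a j)
      (fun j hj => (div_pos (hq0 j) (ha j (by simpa [Nat.lt_succ_iff] using hj))).le)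
      (Finset.mem_range.2 (Nat.lt_succ_of_le hi))
  set R := ∑ j ∈ Finset.range (n + 1), a j * q j
  set D := ∑ j ∈ Finset.range (n + 1), q j / a j
  have hRpos : 0 < R := (mul_pos (ha 0 (by omega)) (hq0 0)).trans_le (hR 0 (by omega))
  have hDpos : 0 < D := (div_pos (hq0 0) (ha 0 (by omega))).trans_le (hδ 0 (by omega))
  have hn0 : (0 : ℝ) < n := by exact_mod_cast hn
  refine ⟨n * R, by positivity, D⁻¹, by positivity, fun x hx hE => ?_⟩
  set ξ := toSeq n x with hξdef
  have hξx : ∀ i : Fin n, ξ (i + 1) = x i := fun i => by simp [hξdef, toSeq]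
  have hξ : ∀ i, 1 ≤ i → i < n → ξ i < ξ (i + 1) := by
    intro i h1 hi
    obtain ⟨j, rfl⟩ : ∃ j, i = j + 1 := ⟨i - 1, by omega⟩
    have := hx ⟨j, by omega⟩ ⟨j + 1, hi⟩ (by simp [Fin.lt_def])
    rwa [← hξx, ← hξx] at this
  have hmass : ∀ i ≤ n, exp (-phaseRate n ξ i / a i ^ 2) ≤ q i * phaseMass n a ξ i := by
    intro i hi
    have := exp_mul_exp_le_phaseMass hn hu ha hk hS1 hS2 hξ hE hi
    rw [exp_neg] at this
    exact (inv_mul_le_iff₀ (hq0 i)).1 this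
  have hmpos : ∀ i ≤ n, 0 < phaseMass n a ξ i := fun i hi => phaseMass_pos hn hi (ha i hi) hξ
  have hbound : ∀ i : Fin n, |x i| ≤ R := by
    intro i
    rw [← hξx i]
    have hi := i.2
    refine abs_le'.2 ⟨?_, ?_⟩
    · rcases le_or_gt (ξ (i + 1)) 0 with h | h
      · linarith
      · refine le_trans ?_ (hR (i + 1) hi)
        have h1 := mul_phaseMass_le_of_pos (by omega) hi (ha _ hi) hξ h
        have h2 := mul_le_mul_of_nonneg_left (hmass _ hi) (ha _ hi).le
        rw [← mul_assoc] at h2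
        exact le_of_mul_le_mul_right (h1.trans h2) (hmpos _ hi)
    · rcases le_or_gt 0 (ξ (i + 1)) with h | h
      · linarith
      · refine le_trans ?_ (hR i hi.le)
        have h1 := mul_phaseMass_le_of_neg hi (ha _ hi.le) hξ h
        have h2 := mul_le_mul_of_nonneg_left (hmass _ hi.le) (ha _ hi.le).le
        rw [← mul_assoc] at h2
        exact le_of_mul_le_mul_right (h1.trans h2) (hmpos _ hi.le)
  refine ⟨?_, fun i h1 hi => ?_⟩
  · have hn1 : (1 : ℝ) ≤ n := by exact_mod_cast hn
    rw [EuclideanSpace.norm_eq]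
    refine Real.sqrt_le_iff.2 ⟨by positivity, ?_⟩
    calc ∑ i, ‖x i‖ ^ 2 ≤ ∑ _i : Fin n, R ^ 2 := by
          refine Finset.sum_le_sum fun i _ => ?_
          exact pow_le_pow_left₀ (norm_nonneg _) (hbound i) 2
      _ = n * R ^ 2 := by simp
      _ ≤ (n * R) ^ 2 := by nlinarith [sq_nonneg R, mul_nonneg (sub_nonneg.2 hn1) hn0.le]
  · have hpos := sub_pos.2 (hξ i h1 hi)
    have h2 := mul_phaseMass_le_width h1 hi (ha i hi.le) (hξ i h1 hi)
    have h3 := mul_le_mul_of_nonneg_left (hmass i hi.le) hpos.le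
    rw [← mul_assoc] at h3
    have h4 := le_of_mul_le_mul_right (h2.trans h3) (hmpos i hi.le)
    refine (inv_le_iff_one_le_mul₀' hDpos).2 ?_
    calc 1 ≤ q i / a i * (ξ (i + 1) - ξ i) := by
          rw [div_mul_eq_mul_div, one_le_div (ha i hi.le), mul_comm]
          exact h4
      _ ≤ D * (ξ (i + 1) - ξ i) := mul_le_mul_of_nonneg_right (hδ i hi.le) hpos.le
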